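/- arXiv:2012.15690 — 2 statements merged into one kernel-verified Lean document; each statement's English description precedes it below -/
import Mathlib

section
/- Let ℚ[X,Y] act on ℚ[a,b] by letting a polynomial F(X,Y) act as the constant-coefficient differential operator F(∂/∂a, ∂/∂b). Then the annihilator ideal Ann(g) := {F ∈ ℚ[X,Y] : F(∂/∂a, ∂/∂b)·g = 0} of the polynomial g = ab + b²/2 ∈ ℚ[a,b] equals the ideal of ℚ[X,Y] generated by X² and Y² − XY. -/
open MvPolynomial

/-- The action of `F ∈ ℚ[X,Y]` on `g ∈ ℚ[a,b]` as the constant-coefficient differential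
operator `F(∂/∂a, ∂/∂b)` (variable `0` is `X ↦ ∂/∂a`, variable `1` is `Y ↦ ∂/∂b`). -/
noncomputable def diffAct2 (F g : MvPolynomial (Fin 2) ℚ) : MvPolynomial (Fin 2) ℚ :=
  ∑ m ∈ F.support, F.coeff m •
    ((fun p => pderiv (0 : Fin 2) p)^[m 0] ((fun p => pderiv (1 : Fin 2) p)^[m 1] g))

theorem dcomm (p : MvPolynomial (Fin 2) ℚ) :
    pderiv (1 : Fin 2) (pderiv (0 : Fin 2) p) = pderiv (0 : Fin 2) (pderiv (1 : Fin 2) p) := by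
  have h : ⁅pderiv (R := ℚ) (1 : Fin 2), pderiv (R := ℚ) (0 : Fin 2)⁆ = 0 := by
    apply MvPolynomial.derivation_ext
    intro i
    fin_cases i <;> simp [Derivation.commutator_apply, pderiv_X]
  have h2 := congrArg (fun D => D p) h
  simpa [Derivation.commutator_apply, sub_eq_zero] using h2

/-- The action on a fixed `g`, as a linear map. -/
noncomputable def actLin (g : MvPolynomial (Fin 2) ℚ) :
    MvPolynomial (Fin 2) ℚ →ₗ[ℚ] MvPolynomial (Fin 2) ℚ :=
  (basisMonomials (Fin 2) ℚ).constr ℚ (fun m =>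
    ((fun p => pderiv (0 : Fin 2) p)^[m 0] ((fun p => pderiv (1 : Fin 2) p)^[m 1] g)))

theorem actLin_mono (g : MvPolynomial (Fin 2) ℚ) (m : Fin 2 →₀ ℕ) :
    actLin g (monomial m 1) =
    ((fun p => pderiv (0 : Fin 2) p)^[m 0] ((fun p => pderiv (1 : Fin 2) p)^[m 1] g)) := by
  have := (basisMonomials (Fin 2) ℚ).constr_basis ℚ (fun m =>
    ((fun p => pderiv (0 : Fin 2) p)^[m 0] ((fun p => pderiv (1 : Fin 2) p)^[m 1] g))) m
  simpa [actLin] using this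

theorem diffAct2_eq (F g : MvPolynomial (Fin 2) ℚ) : diffAct2 F g = actLin g F := by
  conv_rhs => rw [F.as_sum]
  rw [map_sum, diffAct2]
  refine Finset.sum_congr rfl fun m _ => ?_
  rw [← actLin_mono, ← map_smul, smul_monomial, smul_eq_mul, mul_one]

theorem actLin_X (g : MvPolynomial (Fin 2) ℚ) (i : Fin 2) (F : MvPolynomial (Fin 2) ℚ) :
    actLin g (X i * F) = pderiv i (actLin g F) := by
  have h : (actLin g) ∘ₗ (LinearMap.mulLeft ℚ (X i)) = (pderiv i).toLinearMap ∘ₗ actLin g := by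
    refine (basisMonomials (Fin 2) ℚ).ext fun m => ?_
    have e : (X i * monomial m 1 : MvPolynomial (Fin 2) ℚ) =
        monomial (Finsupp.single i 1 + m) 1 := by
      rw [X, monomial_mul, one_mul]
    simp only [coe_basisMonomials, LinearMap.comp_apply, LinearMap.mulLeft_apply, e, actLin_mono]
    fin_cases i
    · simp [add_comm 1, Function.iterate_succ_apply']
    · simp only [Fin.mk_one, Finsupp.add_apply, Finsupp.single_apply]
      simp only [add_comm 1, Function.iterate_succ_apply', if_true, one_ne_zero, if_false, zero_add]
      have hc : Function.Commute (fun p : MvPolynomial (Fin 2) ℚ => pderiv (1 : Fin 2) p)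
        (fun p => pderiv (0 : Fin 2) p) := dcomm
      exact ((hc.iterate_right (m 0)) _).symm
  exact LinearMap.congr_fun h F

theorem actLin_one (g : MvPolynomial (Fin 2) ℚ) : actLin g 1 = g := by
  simpa using actLin_mono g 0

theorem actLin_mul_zero (g F : MvPolynomial (Fin 2) ℚ) (h : actLin g F = 0)
    (G : MvPolynomial (Fin 2) ℚ) : actLin g (G * F) = 0 := by
  induction G using MvPolynomial.induction_on with
  | C a => rw [← smul_eq_C_mul, map_smul, h, smul_zero]
  | add p q hp hq => rw [add_mul, map_add, hp, hq, add_zero]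
  | mul_X p i hp => rw [mul_comm p, mul_assoc, actLin_X, hp, map_zero]

theorem normal_form (F : MvPolynomial (Fin 2) ℚ) : ∃ c0 c1 c2 c3 : ℚ,
    F - (C c0 + C c1 * X 0 + C c2 * X 1 + C c3 * (X 0 * X 1)) ∈
      Ideal.span ({X 0 ^ 2, X 1 ^ 2 - X 0 * X 1} : Set (MvPolynomial (Fin 2) ℚ)) := by
  induction F using MvPolynomial.induction_on with
  | C a => exact ⟨a, 0, 0, 0, by simp⟩
  | add p q hp hq =>
    obtain ⟨a0, a1, a2, a3, ha⟩ := hp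
    obtain ⟨b0, b1, b2, b3, hb⟩ := hq
    refine ⟨a0 + b0, a1 + b1, a2 + b2, a3 + b3, ?_⟩
    convert Ideal.add_mem _ ha hb using 1
    simp only [C_add]
    ring
  | mul_X p i hp =>
    obtain ⟨a0, a1, a2, a3, ha⟩ := hp
    rw [Ideal.mem_span_pair] at ha
    obtain ⟨u, v, h⟩ := ha
    simp only [Ideal.mem_span_pair]
    have hp := eq_add_of_sub_eq h.symm
    fin_cases i
    · refine ⟨0, a0, 0, a2, u * X 0 + C a1 + C a3 * X 1, v * X 0, ?_⟩
      simp only [Fin.zero_eta, C_0]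
      rw [hp]; ring
    · refine ⟨0, 0, a0, a1 + a2, u * X 1 + C a3 * X 1,
        v * X 1 + C a2 + C a3 * X 0, ?_⟩
      simp only [Fin.mk_one, C_0, C_add]
      rw [hp]; ring

theorem ann_trapezoid_volume :
    {F : MvPolynomial (Fin 2) ℚ |
        diffAct2 F (X 0 * X 1 + C (1 / 2 : ℚ) * X 1 ^ 2) = 0} =
      ↑(Ideal.span ({X 0 ^ 2, X 1 ^ 2 - X 0 * X 1} : Set (MvPolynomial (Fin 2) ℚ))) := by
  set g : MvPolynomial (Fin 2) ℚ := X 0 * X 1 + C (1 / 2 : ℚ) * X 1 ^ 2 with hg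
  have hC : (C (1 / 2 : ℚ) * 2 : MvPolynomial (Fin 2) ℚ) = 1 := by
    rw [show (2 : MvPolynomial (Fin 2) ℚ) = C 2 from (map_ofNat C 2).symm, ← C_mul]; norm_num
  have d0 : pderiv (0 : Fin 2) g = X 1 := by
    simp [hg, pderiv_X, Derivation.leibniz]
  have d1 : pderiv (1 : Fin 2) g = X 0 + X 1 := by
    rw [hg]
    simp only [map_add, Derivation.leibniz, pderiv_X_self, pderiv_C, Derivation.leibniz_pow,
      pderiv_X_of_ne (show (0 : Fin 2) ≠ 1 by decide), smul_eq_mul, nsmul_eq_mul]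
    push_cast
    linear_combination (X 1) * hC
  have x0 : actLin g (X 0) = X 1 := by
    rw [← mul_one (X 0), actLin_X, actLin_one, d0]
  have x1 : actLin g (X 1) = X 0 + X 1 := by
    rw [← mul_one (X 1), actLin_X, actLin_one, d1, mul_one]
  have x01 : actLin g (X 0 * X 1) = 1 := by
    rw [actLin_X, x1]; simp [pderiv_X]
  have r0 : actLin g (X 0 ^ 2) = 0 := by
    rw [sq, actLin_X, x0]; simp [pderiv_X]
  have r1 : actLin g (X 1 ^ 2 - X 0 * X 1) = 0 := by
    rw [map_sub, x01, sq, actLin_X, x1]; simp [pderiv_X]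
  have hI : ∀ F ∈ Ideal.span ({X 0 ^ 2, X 1 ^ 2 - X 0 * X 1} : Set (MvPolynomial (Fin 2) ℚ)),
      actLin g F = 0 := by
    intro F hF
    rw [Ideal.mem_span_pair] at hF
    obtain ⟨u, v, rfl⟩ := hF
    rw [map_add, actLin_mul_zero g _ r0, actLin_mul_zero g _ r1, add_zero]
  ext F
  simp only [Set.mem_ofPred_eq, SetLike.mem_coe, diffAct2_eq]
  refine ⟨fun h => ?_, hI F⟩
  obtain ⟨c0, c1, c2, c3, hc⟩ := normal_form F
  have h1 := hI _ hc
  have hA : actLin g (C c0) = C c0 * g := by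
    have e : (C c0 : MvPolynomial (Fin 2) ℚ) = c0 • 1 := by rw [smul_eq_C_mul, mul_one]
    rw [e, map_smul, actLin_one, smul_mul_assoc, one_mul]
  rw [map_sub, h, zero_sub, neg_eq_zero] at h1
  simp only [map_add, ← smul_eq_C_mul, map_smul, x0, x1, x01, hA] at h1
  have ev : ∀ a b : ℚ, c0 * (a * b + 1 / 2 * b ^ 2) + c1 * b + c2 * (a + b) + c3 = 0 := by
    intro a b
    have := congrArg (eval ![a, b]) h1
    simpa [hg, smul_eval, mul_add] using this
  have e1 := ev 0 0
  have e2 := ev 1 0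
  have e3 := ev 0 1
  have e4 := ev 0 (-1)
  have z3 : c3 = 0 := by linarith
  have z2 : c2 = 0 := by linarith
  have z0 : c0 = 0 := by linarith
  have z1 : c1 = 0 := by linarith
  simpa [z0, z1, z2, z3] using hc
end

section
/- Let ℚ[X,Y,Z] act on ℚ[a,b,s] by letting a polynomial F(X,Y,Z) act as the constant-coefficient differential operator F(∂/∂a, ∂/∂b, ∂/∂s). Then the annihilator ideal Ann(g) := {F ∈ ℚ[X,Y,Z] : F(∂/∂a, ∂/∂b, ∂/∂s)·g = 0} of the polynomial g = s·(ab + b²/2) + (s²/2)·(a + b) ∈ ℚ[a,b,s] equals the ideal of ℚ[X,Y,Z] generated by X², Y² − XY, and Z² − YZ + XY. -/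
open MvPolynomial

/-- The action of `F ∈ ℚ[X,Y,Z]` on `g ∈ ℚ[a,b,s]` as the constant-coefficient
differential operator `F(∂/∂a, ∂/∂b, ∂/∂s)` (variable `0` is `X ↦ ∂/∂a`, variable `1`
is `Y ↦ ∂/∂b`, variable `2` is `Z ↦ ∂/∂s`). -/
noncomputable def diffAct3 (F g : MvPolynomial (Fin 3) ℚ) : MvPolynomial (Fin 3) ℚ :=
  ∑ m ∈ F.support, F.coeff m •
    ((fun p => pderiv (0 : Fin 3) p)^[m 0]
      ((fun p => pderiv (1 : Fin 3) p)^[m 1]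
        ((fun p => pderiv (2 : Fin 3) p)^[m 2] g)))

/-- the differential operator attached to an exponent vector -/
noncomputable def monoAct (m : Fin 3 →₀ ℕ) (g : MvPolynomial (Fin 3) ℚ) :
    MvPolynomial (Fin 3) ℚ :=
  ((fun p => pderiv (0 : Fin 3) p)^[m 0]
      ((fun p => pderiv (1 : Fin 3) p)^[m 1]
        ((fun p => pderiv (2 : Fin 3) p)^[m 2] g)))

/-- linear version of the action -/
noncomputable def actL (g : MvPolynomial (Fin 3) ℚ) :
    MvPolynomial (Fin 3) ℚ →ₗ[ℚ] MvPolynomial (Fin 3) ℚ :=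
  (MvPolynomial.basisMonomials (Fin 3) ℚ).constr ℚ (fun m => monoAct m g)

lemma actL_monomial (g : MvPolynomial (Fin 3) ℚ) (m : Fin 3 →₀ ℕ) (c : ℚ) :
    actL g (monomial m c) = c • monoAct m g := by
  have h : monomial m c = c • (MvPolynomial.basisMonomials (Fin 3) ℚ) m := by
    simp [MvPolynomial.coe_basisMonomials, MvPolynomial.smul_monomial]
  rw [h, map_smul, actL, Module.Basis.constr_basis]

lemma diffAct3_eq (F g : MvPolynomial (Fin 3) ℚ) : diffAct3 F g = actL g F := by
  conv_rhs => rw [F.as_sum]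
  rw [map_sum]
  simp only [actL_monomial]
  rfl

lemma pderiv_comm' (i j : Fin 3) :
    Function.Commute (fun p : MvPolynomial (Fin 3) ℚ => pderiv i p) (fun p => pderiv j p) := by
  intro p
  have h : ⁅(pderiv i : Derivation ℚ (MvPolynomial (Fin 3) ℚ) (MvPolynomial (Fin 3) ℚ)),
      (pderiv j : Derivation ℚ (MvPolynomial (Fin 3) ℚ) (MvPolynomial (Fin 3) ℚ))⁆ = 0 := by
    apply MvPolynomial.derivation_ext
    intro k
    rw [Derivation.commutator_apply]
    simp only [pderiv_X, Pi.single_apply]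
    split_ifs <;> simp
  have h2 := congrArg (fun D : Derivation ℚ (MvPolynomial (Fin 3) ℚ) (MvPolynomial (Fin 3) ℚ) => D p) h
  simp only [Derivation.commutator_apply] at h2
  exact sub_eq_zero.mp h2

lemma monoAct_single (i : Fin 3) (m : Fin 3 →₀ ℕ) (g : MvPolynomial (Fin 3) ℚ) :
    monoAct (m + Finsupp.single i 1) g = pderiv i (monoAct m g) := by
  have h01 := (pderiv_comm' 1 0).iterate_right (m 0)
  have h02 := (pderiv_comm' 2 0).iterate_right (m 0)
  have h12 := (pderiv_comm' 2 1).iterate_right (m 1)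
  fin_cases i
  · simp [monoAct, Function.iterate_succ_apply', -Function.iterate_succ]
  · have := h01 ((fun p => pderiv (1 : Fin 3) p)^[m 1]
        ((fun p => pderiv (2 : Fin 3) p)^[m 2] g))
    simp [monoAct, Function.iterate_succ_apply', -Function.iterate_succ]
    exact this.symm
  · have e1 := h02 ((fun p => pderiv (1 : Fin 3) p)^[m 1]
        ((fun p => pderiv (2 : Fin 3) p)^[m 2] g))
    have e2 := h12 ((fun p => pderiv (2 : Fin 3) p)^[m 2] g)
    simp [monoAct, Function.iterate_succ_apply', -Function.iterate_succ]
    simp only at e1 e2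
    rw [e1, e2]

lemma actL_mul_X (g F : MvPolynomial (Fin 3) ℚ) (i : Fin 3) :
    actL g (F * X i) = pderiv i (actL g F) := by
  induction F using MvPolynomial.induction_on' with
  | monomial m c =>
    rw [X, monomial_mul, mul_one, actL_monomial, actL_monomial, monoAct_single, Derivation.map_smul]
  | add p q hp hq => rw [add_mul, map_add, map_add, map_add, hp, hq]

lemma actL_C (g : MvPolynomial (Fin 3) ℚ) (c : ℚ) : actL g (C c) = c • g := by
  rw [C_apply, actL_monomial]; simp [monoAct]

lemma actL_mul_zero (g F p : MvPolynomial (Fin 3) ℚ) (h : actL g F = 0) :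
    actL g (p * F) = 0 := by
  induction p using MvPolynomial.induction_on with
  | C c => rw [← smul_eq_C_mul, map_smul, h, smul_zero]
  | add p q hp hq => rw [add_mul, map_add, hp, hq, add_zero]
  | mul_X p i hp =>
    rw [mul_right_comm, actL_mul_X, hp, map_zero]

/-- the volume polynomial -/
noncomputable def volG : MvPolynomial (Fin 3) ℚ :=
  X 2 * (X 0 * X 1 + C (1 / 2 : ℚ) * X 1 ^ 2) + C (1 / 2 : ℚ) * X 2 ^ 2 * (X 0 + X 1)

lemma C_half_two : (C (1/2 : ℚ) : MvPolynomial (Fin 3) ℚ) * 2 = 1 := by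
  have : (2 : MvPolynomial (Fin 3) ℚ) = C 2 := (map_ofNat C 2).symm
  rw [this, ← C_mul]; norm_num

lemma actL_X (g : MvPolynomial (Fin 3) ℚ) (i : Fin 3) : actL g (X i) = pderiv i g := by
  have := actL_mul_X g (C 1) i
  rw [actL_C, C_1, one_mul, one_smul] at this
  exact this

set_option linter.unusedSimpArgs false

lemma d0 : pderiv 0 volG = X 2 * X 1 + C (1/2 : ℚ) * X 2 ^ 2 := by
  simp [volG, pderiv_X, Pi.single_apply, Derivation.leibniz, Derivation.leibniz_pow, -map_div₀, -one_div]
lemma d1 : pderiv 1 volG = X 2 * (X 0 + X 1) + C (1/2 : ℚ) * X 2 ^ 2 := by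
  simp [volG, pderiv_X, Pi.single_apply, Derivation.leibniz, Derivation.leibniz_pow, -map_div₀, -one_div]
  linear_combination X 1 * C_half_two
lemma d2 : pderiv 2 volG = X 0 * X 1 + C (1/2 : ℚ) * X 1 ^ 2 + X 2 * (X 0 + X 1) := by
  simp [volG, pderiv_X, Pi.single_apply, Derivation.leibniz, Derivation.leibniz_pow, -map_div₀, -one_div]
  linear_combination X 2 * (X 0 + X 1) * C_half_two

lemma d00 : pderiv 0 (pderiv 0 volG) = 0 := by
  simp [d0, pderiv_X, Pi.single_apply, Derivation.leibniz, Derivation.leibniz_pow, -map_div₀, -one_div]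
lemma d01 : pderiv 1 (pderiv 0 volG) = X 2 := by
  simp [d0, pderiv_X, Pi.single_apply, Derivation.leibniz, Derivation.leibniz_pow, -map_div₀, -one_div]
lemma d02 : pderiv 2 (pderiv 0 volG) = X 1 + X 2 := by
  simp [d0, pderiv_X, Pi.single_apply, Derivation.leibniz, Derivation.leibniz_pow, -map_div₀, -one_div]
  linear_combination X 2 * C_half_two
lemma d11 : pderiv 1 (pderiv 1 volG) = X 2 := by
  simp [d1, pderiv_X, Pi.single_apply, Derivation.leibniz, Derivation.leibniz_pow, -map_div₀, -one_div]
lemma d12 : pderiv 2 (pderiv 1 volG) = X 0 + X 1 + X 2 := by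
  simp [d1, pderiv_X, Pi.single_apply, Derivation.leibniz, Derivation.leibniz_pow, -map_div₀, -one_div]
  linear_combination X 2 * C_half_two
lemma d22 : pderiv 2 (pderiv 2 volG) = X 0 + X 1 := by
  simp [d2, pderiv_X, Pi.single_apply, Derivation.leibniz, Derivation.leibniz_pow, -map_div₀, -one_div]

/-- the ideal -/
noncomputable def relI : Ideal (MvPolynomial (Fin 3) ℚ) :=
  Ideal.span ({X 0 ^ 2, X 1 ^ 2 - X 0 * X 1, X 2 ^ 2 - X 1 * X 2 + X 0 * X 1} :
        Set (MvPolynomial (Fin 3) ℚ))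

lemma act_of_mem (F : MvPolynomial (Fin 3) ℚ) (h : F ∈ relI) : actL volG F = 0 := by
  induction h using Submodule.span_induction with
  | zero => exact map_zero _
  | add p q _ _ hp hq => rw [map_add, hp, hq, add_zero]
  | smul a p _ hp => exact actL_mul_zero _ _ _ hp
  | mem p hp =>
    rcases hp with rfl | rfl | rfl
    · simp only [pow_two, actL_mul_X, actL_X, d00]
    · simp only [pow_two, map_sub, actL_mul_X, actL_X, d11, d01, sub_self]
    · simp only [pow_two, map_sub, map_add, actL_mul_X, actL_X, d22, d12, d01]
      ring

/-- normal forms modulo the ideal -/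
noncomputable def nf (c : Fin 8 → ℚ) : MvPolynomial (Fin 3) ℚ :=
  C (c 0) + C (c 1) * X 0 + C (c 2) * X 1 + C (c 3) * X 2 + C (c 4) * (X 0 * X 1)
    + C (c 5) * (X 0 * X 2) + C (c 6) * (X 1 * X 2) + C (c 7) * (X 0 * X 1 * X 2)

lemma exists_nf (F : MvPolynomial (Fin 3) ℚ) : ∃ c, F - nf c ∈ relI := by
  have hx : (X 0 ^ 2 : MvPolynomial (Fin 3) ℚ) ∈ relI := Ideal.subset_span (by simp)
  have hy : (X 1 ^ 2 - X 0 * X 1 : MvPolynomial (Fin 3) ℚ) ∈ relI := Ideal.subset_span (by simp)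
  have hz : (X 2 ^ 2 - X 1 * X 2 + X 0 * X 1 : MvPolynomial (Fin 3) ℚ) ∈ relI :=
    Ideal.subset_span (by simp)
  rw [← Ideal.Quotient.eq_zero_iff_mem] at hx hy hz
  simp only [← Ideal.Quotient.eq_zero_iff_mem]
  simp only [nf, map_add, map_sub, map_mul, map_pow] at hx hy hz ⊢
  induction F using MvPolynomial.induction_on with
  | C a => exact ⟨![a, 0, 0, 0, 0, 0, 0, 0], by simp⟩
  | add p q hp hq =>
    obtain ⟨c, hc⟩ := hp
    obtain ⟨d, hd⟩ := hq
    refine ⟨c + d, ?_⟩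
    simp only [Pi.add_apply, map_add]
    linear_combination hc + hd
  | mul_X p i hp =>
    obtain ⟨c, hc⟩ := hp
    rw [map_mul]
    fin_cases i
    · refine ⟨![0, c 0, 0, 0, c 2, c 3, 0, c 6], ?_⟩
      simp [-map_mul]
      generalize (Ideal.Quotient.mk relI) (X 0) = x at *
      generalize (Ideal.Quotient.mk relI) (X 1) = y at *
      generalize (Ideal.Quotient.mk relI) (X 2) = z at *
      generalize (Ideal.Quotient.mk relI) (C (c 1)) = c1 at *
      generalize (Ideal.Quotient.mk relI) (C (c 4)) = c4 at *
      generalize (Ideal.Quotient.mk relI) (C (c 5)) = c5 at *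
      generalize (Ideal.Quotient.mk relI) (C (c 7)) = c7 at *
      linear_combination x * hc + (c1 + c4 * y + c5 * z + c7 * y * z) * hx
    · refine ⟨![0, 0, c 0, 0, c 1 + c 2, 0, c 3, c 5 + c 6], ?_⟩
      simp [-map_mul]
      generalize (Ideal.Quotient.mk relI) (X 0) = x at *
      generalize (Ideal.Quotient.mk relI) (X 1) = y at *
      generalize (Ideal.Quotient.mk relI) (X 2) = z at *
      generalize (Ideal.Quotient.mk relI) (C (c 2)) = c2 at *
      generalize (Ideal.Quotient.mk relI) (C (c 4)) = c4 at *
      generalize (Ideal.Quotient.mk relI) (C (c 6)) = c6 at *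
      generalize (Ideal.Quotient.mk relI) (C (c 7)) = c7 at *
      linear_combination y * hc + (c2 + c4 * x + c6 * z + c7 * x * z) * hy
        + (c4 * y + c7 * y * z) * hx
    · refine ⟨![0, 0, 0, c 0, - c 3, c 1, c 2 + c 3, c 4 + c 5 + c 6], ?_⟩
      simp [-map_mul]
      generalize (Ideal.Quotient.mk relI) (X 0) = x at *
      generalize (Ideal.Quotient.mk relI) (X 1) = y at *
      generalize (Ideal.Quotient.mk relI) (X 2) = z at *
      generalize (Ideal.Quotient.mk relI) (C (c 3)) = c3 at *
      generalize (Ideal.Quotient.mk relI) (C (c 5)) = c5 at *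
      generalize (Ideal.Quotient.mk relI) (C (c 6)) = c6 at *
      generalize (Ideal.Quotient.mk relI) (C (c 7)) = c7 at *
      linear_combination z * hc + (c3 + c5 * x + c6 * y + c7 * x * y) * hz
        - c5 * y * hx + c6 * ((z - x) * hy - y * hx)
        + c7 * (x * (z - x) * hy + y * (z - x) * hx - x * y * hx + x * y * hx)

/-- The annihilator of the volume polynomial `g = s(ab + b²/2) + (s²/2)(a + b)` of the
push-pull polytope under the differential-operator action of `ℚ[X,Y,Z]` is the ideal
generated by `X²`, `Y² − XY` and `Z² − YZ + XY`.  This identifies its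
Khovanskii–Pukhlikov ring with `ℚ[∂_s, ∂_a, ∂_b]/(∂_a², ∂_b² − ∂_a∂_b, ∂_s² − ∂_b∂_s + ∂_a∂_b)`. -/
theorem ann_pushPull_volume :
    {F : MvPolynomial (Fin 3) ℚ |
        diffAct3 F (X 2 * (X 0 * X 1 + C (1 / 2 : ℚ) * X 1 ^ 2) +
          C (1 / 2 : ℚ) * X 2 ^ 2 * (X 0 + X 1)) = 0} =
      ↑(Ideal.span ({X 0 ^ 2, X 1 ^ 2 - X 0 * X 1, X 2 ^ 2 - X 1 * X 2 + X 0 * X 1} :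
        Set (MvPolynomial (Fin 3) ℚ))) := by
  change {F | diffAct3 F volG = 0} = (relI : Set (MvPolynomial (Fin 3) ℚ))
  ext F
  simp only [Set.mem_setOf_eq, SetLike.mem_coe, diffAct3_eq]
  refine ⟨fun h => ?_, act_of_mem F⟩
  obtain ⟨c, hc⟩ := exists_nf F
  have h1 := act_of_mem _ hc
  rw [map_sub, h, zero_sub, neg_eq_zero] at h1
  simp only [nf, map_add, ← smul_eq_C_mul, map_smul, actL_C, actL_mul_X, actL_X, d01, d02, d12] at h1
  rw [d0, d1, d2] at h1
  simp only [volG, pderiv_X_self] at h1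
  have ev : ∀ a b s : ℚ, _ := fun a b s => congrArg (MvPolynomial.eval ![a, b, s]) h1
  simp [-one_div] at ev
  have e0 := ev 0 0 0
  have e1 := ev 0 0 1
  have e2 := ev 0 0 (-1)
  have e3 := ev 1 0 0
  have e4 := ev 0 1 0
  have e5 := ev 0 (-1) 0
  have e6 := ev 1 0 1
  have e7 := ev 0 1 1
  have e8 := ev 1 1 0
  have e9 := ev 1 1 1
  have e10 := ev 1 (-1) 1
  have e11 := ev 1 0 (-1)
  have e12 := ev 1 1 (-1)
  norm_num at e0 e1 e2 e3 e4 e5 e6 e7 e8 e9 e10 e11 e12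
  have z0 : c 0 = 0 := by linarith
  have z1 : c 1 = 0 := by linarith
  have z2 : c 2 = 0 := by linarith
  have z3 : c 3 = 0 := by linarith
  have z4 : c 4 = 0 := by linarith
  have z5 : c 5 = 0 := by linarith
  have z6 : c 6 = 0 := by linarith
  have z7 : c 7 = 0 := by linarith
  have : nf c = 0 := by simp [nf, z0, z1, z2, z3, z4, z5, z6, z7]
  rwa [this, sub_zero] at hc
end
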